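/- (Mixed-norm Gagliardo–Nirenberg interpolation) For a measurable function $g$ on $\mathbb R\times\mathbb R^d$ and exponents $q\in(0,\infty]$, $p\in[1,\infty]$ put $$\|g\|_{\mathbb L^{q,p}_{t,x}}:=\Big(\int_{\mathbb R}\Big(\int_{\mathbb R^d}|g(t,x)|^p\,dx\Big)^{q/p}dt\Big)^{1/q},$$ with the usual essential-supremum modification when an exponent is $\infty$, and let $\nabla_x f$ denote the gradient of $f$ in the variable $x\in\mathbb R^d$. Let $d\ge 2$. Fix $\varkappa\in[2d/(d+2),2]$ and $\theta\in[0,1]$, excluding the case $\theta=1$ and $\varkappa=d$, and let $r\ge2$ satisfy $$\tfrac12-\tfrac1r=\tfrac\theta2\Big(\tfrac2d+1-\tfrac2\varkappa\Big).$$ Then there is a constant $C=C(\varkappa,d,r,\theta)>0$ such that for every real $s\ge1$ with $s\theta\le2$, where in the case $\theta=1$ it is moreover required that $s=2$, and for every real-valued $f\in C_c^\infty(\mathbb R^{1+d})$, $$\|f\|_{\mathbb L^{s,r}_{t,x}}\le C\,\|\nabla_x f\|_{\mathbb L^{2,\varkappa}_{t,x}}^{\theta}\;\|f\|_{\mathbb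 L^{2(1-\theta)s/(2-s\theta),\,2}_{t,x}}^{1-\theta}.$$ Here the exponent $2(1-\theta)s/(2-s\theta)$ is read as $\infty$ if $\theta<1$ and $s\theta=2$, and any factor raised to the power $0$ is read as $1$ (the last factor if $\theta=1$, the gradient factor if $\theta=0$). -/

import Mathlib

open MeasureTheory
open scoped ENNReal ContDiff

/-- The mixed norm `‖f‖_{𝕃^{q,p}_{t,x}}` of a function on `ℝ × ℝ^d`: the `L^q` norm in time of the
`L^p` norm in space, with values in `[0,∞]`. For `0 < q < ∞` and `0 < p < ∞` it is
`(∫ (∫ |f(t,x)|^p dx)^(q/p) dt)^(1/q)`; the exponent `∞` means the essential supremum. -/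
noncomputable def mixedNorm {d : ℕ} {F : Type*} [NormedAddCommGroup F] (q p : ℝ≥0∞)
    (f : ℝ × EuclideanSpace ℝ (Fin d) → F) : ℝ≥0∞ :=
  eLpNorm (fun t : ℝ => eLpNorm (fun x : EuclideanSpace ℝ (Fin d) => f (t, x)) p volume) q volume

/-- The spatial gradient `∇_x f`. -/
noncomputable def spatialGradient {d : ℕ} (f : ℝ × EuclideanSpace ℝ (Fin d) → ℝ) :
    ℝ × EuclideanSpace ℝ (Fin d) → EuclideanSpace ℝ (Fin d) :=
  fun z => gradient (fun y : EuclideanSpace ℝ (Fin d) => f (z.1, y)) z.2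

/-- The time exponent `2(1-θ)s/(2-sθ)`. For `θ < 1` it is positive, and it is `∞` if `sθ = 2`.
For `θ = 1` (and `s = 2`) the quotient is the meaningless `0/0`; the value `0` given by the division
is then irrelevant, because the norm with this exponent only appears to the power `1 - θ = 0`. -/
noncomputable def timeExponent (θ s : ℝ) : ℝ≥0∞ :=
  ENNReal.ofReal (2 * (1 - θ) * s) / ENNReal.ofReal (2 - s * θ)

open scoped NNReal

section Interpolation

variable {α : Type*} [MeasurableSpace α] {μ : Measure α}

lemma eLpNorm_ofReal_eq_lintegral {ε : Type*} [ENorm ε] {p : ℝ} (hp : 0 < p) (f : α → ε) :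
    eLpNorm f (ENNReal.ofReal p) μ = (∫⁻ a, ‖f a‖ₑ ^ p ∂μ) ^ (1 / p) := by
  rw [eLpNorm_eq_lintegral_rpow_enorm_toReal (by simpa using hp) ENNReal.ofReal_ne_top,
    ENNReal.toReal_ofReal hp.le]

/-- Hölder's inequality for a geometric mean, with finite exponents. -/
lemma eLpNorm_rpow_mul_rpow_le {G H : α → ℝ≥0∞} (hG : AEMeasurable G μ) (hH : AEMeasurable H μ)
    {p q s θ : ℝ} (hp : 0 < p) (hq : 0 < q) (hs : 0 < s) (hθ : 0 ≤ θ) (hθ' : θ ≤ 1)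
    (h : 1 / s = θ / p + (1 - θ) / q) :
    eLpNorm (fun a => G a ^ θ * H a ^ (1 - θ)) (ENNReal.ofReal s) μ ≤
      eLpNorm G (ENNReal.ofReal p) μ ^ θ * eLpNorm H (ENNReal.ofReal q) μ ^ (1 - θ) := by
  have hθ1 : 0 ≤ 1 - θ := by linarith
  rw [eLpNorm_ofReal_eq_lintegral hs, eLpNorm_ofReal_eq_lintegral hp,
    eLpNorm_ofReal_eq_lintegral hq]
  simp only [enorm_eq_self]
  have key := ENNReal.lintegral_mul_norm_pow_le (μ := μ) (hG.pow_const p) (hH.pow_const q)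
    (p := s * (θ / p)) (q := s * ((1 - θ) / q)) (by positivity) (by positivity)
    (by rw [← mul_add, ← h]; field_simp)
  have e : ∀ a, (G a ^ p) ^ (s * (θ / p)) * (H a ^ q) ^ (s * ((1 - θ) / q)) =
      (G a ^ θ * H a ^ (1 - θ)) ^ s := fun a => by
    rw [ENNReal.mul_rpow_of_nonneg _ _ hs.le]
    simp only [← ENNReal.rpow_mul]
    congr 2 <;> field_simp
  simp only [e] at key
  refine (ENNReal.rpow_le_rpow key (by positivity : 0 ≤ 1 / s)).trans_eq ?_
  rw [ENNReal.mul_rpow_of_nonneg _ _ (by positivity)]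
  simp only [← ENNReal.rpow_mul]
  congr 2 <;> field_simp

/-- Hölder's inequality for a geometric mean whose second factor is measured in `L^∞`. -/
lemma eLpNorm_rpow_mul_rpow_le_top {G H : α → ℝ≥0∞} (hG : AEMeasurable G μ)
    {p s θ : ℝ} (hs : 0 < s) (hθ : 0 < θ) (hθ' : θ ≤ 1) (h : s * θ = p) :
    eLpNorm (fun a => G a ^ θ * H a ^ (1 - θ)) (ENNReal.ofReal s) μ ≤
      eLpNorm G (ENNReal.ofReal p) μ ^ θ * eLpNorm H ∞ μ ^ (1 - θ) := by
  have hθ1 : 0 ≤ 1 - θ := by linarith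
  have hp : 0 < p := h ▸ mul_pos hs hθ
  rw [eLpNorm_ofReal_eq_lintegral hs, eLpNorm_ofReal_eq_lintegral hp]
  simp only [enorm_eq_self]
  set M := eLpNorm H ∞ μ
  have hM : ∀ᵐ a ∂μ, H a ≤ M := by
    simpa [M, eLpNorm_exponent_top] using enorm_ae_le_eLpNormEssSup H μ
  have key : ∫⁻ a, (G a ^ θ * H a ^ (1 - θ)) ^ s ∂μ ≤
      (∫⁻ a, G a ^ p ∂μ) * M ^ ((1 - θ) * s) := by
    rw [← lintegral_mul_const'' _ (hG.pow_const p)]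
    refine lintegral_mono_ae (hM.mono fun a ha => ?_)
    rw [ENNReal.mul_rpow_of_nonneg _ _ hs.le, ← ENNReal.rpow_mul, ← ENNReal.rpow_mul,
      mul_comm θ s, h]
    gcongr
  refine (ENNReal.rpow_le_rpow key (by positivity : 0 ≤ 1 / s)).trans_eq ?_
  rw [ENNReal.mul_rpow_of_nonneg _ _ (by positivity)]
  simp only [← ENNReal.rpow_mul]
  subst h
  congr 2 <;> field_simp

/-- Lyapunov's inequality: log-convexity of `L^p` norms. -/
lemma eLpNorm_le_rpow_mul_rpow {F : Type*} [NormedAddCommGroup F] {u : α → F}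
    (hu : AEStronglyMeasurable u μ)
    {p q s θ : ℝ} (hp : 0 < p) (hq : 0 < q) (hs : 0 < s) (hθ : 0 ≤ θ) (hθ' : θ ≤ 1)
    (h : 1 / s = θ / p + (1 - θ) / q) :
    eLpNorm u (ENNReal.ofReal s) μ ≤
      eLpNorm u (ENNReal.ofReal p) μ ^ θ * eLpNorm u (ENNReal.ofReal q) μ ^ (1 - θ) := by
  have := eLpNorm_rpow_mul_rpow_le hu.enorm hu.enorm hp hq hs hθ hθ' h
  simp only [← ENNReal.rpow_add_of_nonneg _ _ hθ (sub_nonneg.2 hθ'), add_sub_cancel,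
    ENNReal.rpow_one, eLpNorm_enorm] at this
  exact this

end Interpolation

section Spatial

variable {E : Type*} [NormedAddCommGroup E] [NormedSpace ℝ E]
  [MeasurableSpace E] [BorelSpace E] (μ : Measure E)

/-- A Gagliardo–Nirenberg inequality with weight `a` on the gradient implies those with smaller
weight. -/
lemma exists_gagliardo_nirenberg_of_le {κ a p θ r : ℝ} (hp : 0 < p) (hr : 0 < r)
    (ha : 0 < a) (ha1 : a ≤ 1) (hθ : 0 ≤ θ) (hθa : θ ≤ a)
    (h : 1 / r = θ / a / p + (1 - θ / a) / 2)
    (H : ∃ C : ℝ≥0, ∀ u : E → ℝ, ContDiff ℝ 1 u → HasCompactSupport u →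
      eLpNorm u (ENNReal.ofReal p) μ ≤
        C * eLpNorm (fderiv ℝ u) (ENNReal.ofReal κ) μ ^ a * eLpNorm u 2 μ ^ (1 - a)) :
    ∃ C : ℝ≥0, ∀ u : E → ℝ, ContDiff ℝ 1 u → HasCompactSupport u →
      eLpNorm u (ENNReal.ofReal r) μ ≤
        C * eLpNorm (fderiv ℝ u) (ENNReal.ofReal κ) μ ^ θ * eLpNorm u 2 μ ^ (1 - θ) := by
  obtain ⟨C, hC⟩ := H
  refine ⟨C ^ (θ / a), fun u hu hcu => ?_⟩
  have hb : 0 ≤ θ / a := by positivity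
  have hb1 : θ / a ≤ 1 := (div_le_one ha).2 hθa
  have h1 := eLpNorm_le_rpow_mul_rpow (μ := μ) hu.continuous.aestronglyMeasurable
    hp two_pos hr hb hb1 h
  rw [ENNReal.ofReal_ofNat] at h1
  calc _ ≤ _ := h1
    _ ≤ (C * eLpNorm (fderiv ℝ u) (ENNReal.ofReal κ) μ ^ a * eLpNorm u 2 μ ^ (1 - a)) ^ (θ / a) *
          eLpNorm u 2 μ ^ (1 - θ / a) := by gcongr; exact hC u hu hcu
    _ = _ := by
      rw [ENNReal.mul_rpow_of_nonneg _ _ hb, ENNReal.mul_rpow_of_nonneg _ _ hb,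
        ← ENNReal.rpow_mul, ← ENNReal.rpow_mul, mul_assoc,
        ← ENNReal.rpow_add_of_nonneg _ _ (mul_nonneg (sub_nonneg.2 ha1) hb) (sub_nonneg.2 hb1),
        ENNReal.coe_rpow_of_nonneg _ hb]
      congr 2
      · congr 1; field_simp
      · field_simp; ring

variable [FiniteDimensional ℝ E] [μ.IsAddHaarMeasure]

/-- In dimension two, powers of a test function are controlled in `L^2` by the function and its
gradient. -/
lemma eLpNorm_pow_le_of_finrank_eq_two (hE : Module.finrank ℝ E = 2) (k : ℕ) :
    ∃ C : ℝ≥0, ∀ u : E → ℝ, ContDiff ℝ 1 u → HasCompactSupport u →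
      eLpNorm (fun x => u x ^ (k + 1)) 2 μ ≤
        C * eLpNorm u 2 μ * eLpNorm (fderiv ℝ u) 2 μ ^ k := by
  induction k with
  | zero => exact ⟨1, fun u _ _ => by simp⟩
  | succ k ih =>
    obtain ⟨C, hC⟩ := ih
    refine ⟨eLpNormLESNormFDerivOneConst μ (2 : ℝ≥0) * (k + 2) * C, fun u hu hcu => ?_⟩
    have hpow : ContDiff ℝ 1 (fun x => u x ^ (k + 1 + 1)) := hu.pow _
    have hcpow : HasCompactSupport (fun x => u x ^ (k + 1 + 1)) :=
      hcu.comp_left (g := fun y => y ^ (k + 1 + 1)) (by simp)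
    have hconj : NNReal.HolderConjugate (Module.finrank ℝ E) (2 : ℝ≥0) := by
      rw [hE, NNReal.holderConjugate_iff]
      norm_num
    have hsob := eLpNorm_le_eLpNorm_fderiv_one μ hpow hcpow hconj
    have hfd : fderiv ℝ (fun x => u x ^ (k + 1 + 1)) =
        ((k : ℝ) + 2) • ((fun x => u x ^ (k + 1)) • fderiv ℝ u) := by
      funext x
      rw [fderiv_fun_pow _ (hu.differentiable one_ne_zero x)]
      ext v
      simp
      ring
    have hhol : eLpNorm ((fun x => u x ^ (k + 1)) • fderiv ℝ u) 1 μ ≤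
        eLpNorm (fun x => u x ^ (k + 1)) 2 μ * eLpNorm (fderiv ℝ u) 2 μ :=
      eLpNorm_smul_le_mul_eLpNorm
        (hu.continuous_fderiv one_ne_zero).aestronglyMeasurable
        (hu.continuous.pow _).aestronglyMeasurable
    have hk : ‖(k : ℝ) + 2‖ₑ = ((k + 2 : ℝ≥0) : ℝ≥0∞) := by
      rw [← ofReal_norm, Real.norm_of_nonneg (by positivity), ENNReal.ofReal]
      congr 1
      ext
      rw [Real.coe_toNNReal _ (by positivity)]
      simp
    have hsmul := eLpNorm_const_smul ((k : ℝ) + 2) ((fun x => u x ^ (k + 1)) • fderiv ℝ u) 1 μ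
    rw [hk] at hsmul
    rw [hfd] at hsob
    replace hsob := hsob.trans_eq (congrArg _ hsmul)
    calc _ ≤ _ := hsob
      _ ≤ eLpNormLESNormFDerivOneConst μ (2 : ℝ≥0) * (((k + 2 : ℝ≥0) : ℝ≥0∞) *
            ((C * eLpNorm u 2 μ * eLpNorm (fderiv ℝ u) 2 μ ^ k) *
              eLpNorm (fderiv ℝ u) 2 μ)) := by
          gcongr
          exact hhol.trans (by gcongr; exact hC u hu hcu)
      _ = _ := by push_cast; ring

/-- The Gagliardo–Nirenberg inequality between `L^2` and the Sobolev endpoint. -/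
lemma exists_gagliardo_nirenberg {κ θ r : ℝ}
    (hd : 2 ≤ Module.finrank ℝ E)
    (hκ : κ ∈ Set.Icc (2 * (Module.finrank ℝ E : ℝ) / ((Module.finrank ℝ E : ℝ) + 2)) 2)
    (hθ : θ ∈ Set.Icc (0 : ℝ) 1)
    (hexc : ¬ (θ = 1 ∧ κ = (Module.finrank ℝ E : ℝ))) (hr : 2 ≤ r)
    (hbal : 1 / 2 - 1 / r = θ / 2 * (2 / (Module.finrank ℝ E : ℝ) + 1 - 2 / κ)) :
    ∃ C : ℝ≥0, ∀ u : E → ℝ, ContDiff ℝ 1 u → HasCompactSupport u →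
      eLpNorm u (ENNReal.ofReal r) μ ≤
        C * eLpNorm (fderiv ℝ u) (ENNReal.ofReal κ) μ ^ θ * eLpNorm u 2 μ ^ (1 - θ) := by
  set n := Module.finrank ℝ E with hn
  have hn2 : (2 : ℝ) ≤ n := by exact_mod_cast hd
  have hκ1 : 1 ≤ κ := le_trans (by rw [le_div_iff₀] <;> linarith) hκ.1
  have hκ0 : 0 < κ := by linarith
  have hκn : κ ≤ n := hκ.2.trans hn2
  rcases hκn.lt_or_eq with hlt | heq
  · have hpos : 0 < κ⁻¹ - (n : ℝ)⁻¹ := sub_pos.2 (inv_strictAnti₀ hκ0 hlt)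
    refine exists_gagliardo_nirenberg_of_le μ (p := (κ⁻¹ - (n : ℝ)⁻¹)⁻¹) (a := 1)
      (inv_pos.2 hpos) (by linarith) one_pos le_rfl hθ.1 hθ.2 ?_ ?_
    · rw [div_one, div_inv_eq_mul]
      linear_combination -hbal
    · refine ⟨eLpNormLESNormFDerivOfEqInnerConst μ κ.toNNReal, fun u hu hcu => ?_⟩
      have := eLpNorm_le_eLpNorm_fderiv_of_eq_inner μ hu hcu (p := κ.toNNReal)
        (p' := ((κ⁻¹ - (n : ℝ)⁻¹)⁻¹).toNNReal) (by simpa using hκ1) (by omega)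
        (by rw [Real.coe_toNNReal _ (inv_pos.2 hpos).le, inv_inv, NNReal.coe_inv,
              Real.coe_toNNReal _ hκ0.le])
      simpa [ENNReal.ofReal, Real.coe_toNNReal _ hκ0.le] using this
  · have hκ2 : κ = 2 := le_antisymm hκ.2 (heq ▸ hn2)
    have hn' : (n : ℝ) = 2 := heq ▸ hκ2
    have hnN : n = 2 := by exact_mod_cast hn'
    have hθ1 : θ < 1 := lt_of_le_of_ne hθ.2 fun h => hexc ⟨h, heq⟩
    obtain ⟨m, hm⟩ := exists_nat_gt (1 / (1 - θ))
    set k : ℕ := m + 1 with hk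
    have hkR : (0 : ℝ) < k := by positivity
    have hle : θ ≤ (k : ℝ) / (k + 1) := by
      have h1 : 1 < m * (1 - θ) := (div_lt_iff₀ (by linarith)).1 hm
      rw [le_div_iff₀ (by positivity)]
      rw [hk]; push_cast
      nlinarith [hθ.1]
    refine exists_gagliardo_nirenberg_of_le μ (p := 2 * ((k : ℝ) + 1)) (a := (k : ℝ) / (k + 1))
      (by positivity) (by linarith) (by positivity)
      ((div_le_one (by positivity)).2 (by linarith)) hθ.1 hle ?_ ?_
    · rw [hn', hκ2] at hbal
      have : 1 / r = 1 / 2 - θ / 2 := by linear_combination -hbal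
      rw [this]; field_simp; ring
    · obtain ⟨C, hC⟩ := eLpNorm_pow_le_of_finrank_eq_two μ (hn ▸ hnN) k
      refine ⟨C ^ (1 / ((k : ℝ) + 1)), fun u hu hcu => ?_⟩
      have hk1 : (0 : ℝ) < (k : ℝ) + 1 := by positivity
      have hpow : eLpNorm u (ENNReal.ofReal (2 * ((k : ℝ) + 1))) μ =
          eLpNorm (fun x => u x ^ (k + 1)) 2 μ ^ (1 / ((k : ℝ) + 1)) := by
        have h1 := eLpNorm_norm_rpow (μ := μ) (p := 2) u hk1
        rw [ENNReal.ofReal_mul two_pos.le, ENNReal.ofReal_ofNat,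
          show eLpNorm (fun x => u x ^ (k + 1)) 2 μ =
            eLpNorm (fun x => ‖u x‖ ^ ((k : ℝ) + 1)) 2 μ from
            eLpNorm_congr_norm_ae (.of_forall fun x => by
              rw [← Nat.cast_succ, Real.rpow_natCast]; simp), h1, ← ENNReal.rpow_mul,
          mul_one_div_cancel hk1.ne', ENNReal.rpow_one]
      rw [hpow, hκ2, ENNReal.ofReal_ofNat]
      refine (ENNReal.rpow_le_rpow (hC u hu hcu) (by positivity)).trans_eq ?_
      have hi : 0 ≤ 1 / ((k : ℝ) + 1) := by positivity
      rw [ENNReal.mul_rpow_of_nonneg _ _ hi, ENNReal.mul_rpow_of_nonneg _ _ hi,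
        ENNReal.coe_rpow_of_nonneg _ hi, ← ENNReal.rpow_natCast, ← ENNReal.rpow_mul,
        mul_one_div, mul_right_comm]
      congr 2
      field_simp
      ring

end Spatial

section MixedNorm

variable {d : ℕ}

lemma measurable_eLpNorm_slice {F : Type*} [NormedAddCommGroup F] {p : ℝ} (hp : 0 < p)
    {g : ℝ × EuclideanSpace ℝ (Fin d) → F} (hg : Continuous g) :
    Measurable fun t : ℝ => eLpNorm (fun x => g (t, x)) (ENNReal.ofReal p) volume := by
  simp only [eLpNorm_ofReal_eq_lintegral hp]
  exact (Measurable.lintegral_prod_right' (hg.enorm.measurable.pow_const p)).pow_const _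

lemma norm_spatialGradient (f : ℝ × EuclideanSpace ℝ (Fin d) → ℝ) (t : ℝ)
    (x : EuclideanSpace ℝ (Fin d)) :
    ‖spatialGradient f (t, x)‖ = ‖fderiv ℝ (fun y => f (t, y)) x‖ := by
  simp [spatialGradient, gradient]

lemma continuous_spatialGradient {f : ℝ × EuclideanSpace ℝ (Fin d) → ℝ} (hf : ContDiff ℝ ∞ f) :
    Continuous (spatialGradient f) := by
  have h : spatialGradient f = fun z => (InnerProductSpace.toDual ℝ _).symm
      ((fderiv ℝ f z).comp (ContinuousLinearMap.inr ℝ ℝ (EuclideanSpace ℝ (Fin d)))) := by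
    funext ⟨t, x⟩
    simp only [spatialGradient, gradient]
    congr 1
    exact (((hf.differentiable (by simp)) (t, x)).hasFDerivAt.comp x
      (hasFDerivAt_prodMk_right t x)).fderiv
  rw [h]
  exact (LinearIsometryEquiv.continuous _).comp
    ((hf.continuous_fderiv (by simp)).clm_comp continuous_const)

lemma HasCompactSupport.slice {f : ℝ × EuclideanSpace ℝ (Fin d) → ℝ} (hf : HasCompactSupport f)
    (t : ℝ) : HasCompactSupport fun x => f (t, x) :=
  hf.comp_isClosedEmbedding
    (Isometry.of_dist_eq fun x y => by simp [Prod.dist_eq]).isClosedEmbedding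

/-- Hölder's inequality in time, for the exponents of the mixed-norm inequality. -/
lemma eLpNorm_rpow_mul_rpow_le_timeExponent {α : Type*} [MeasurableSpace α] {μ : Measure α}
    {G H : α → ℝ≥0∞} (hG : AEMeasurable G μ) (hH : AEMeasurable H μ) {s θ : ℝ} (hs : 1 ≤ s)
    (hθ : θ ∈ Set.Icc (0 : ℝ) 1) (hsθ : s * θ ≤ 2) (hθs : θ = 1 → s = 2) :
    eLpNorm (fun a => G a ^ θ * H a ^ (1 - θ)) (ENNReal.ofReal s) μ ≤
      eLpNorm G 2 μ ^ θ * eLpNorm H (timeExponent θ s) μ ^ (1 - θ) := by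
  have hs0 : 0 < s := by linarith
  rcases hθ.2.lt_or_eq with h1 | rfl
  · have hnum : 0 < 2 * (1 - θ) * s := by have := sub_pos.2 h1; positivity
    rcases hsθ.lt_or_eq with hlt | heq
    · have hden : 0 < 2 - s * θ := by linarith
      rw [timeExponent, ← ENNReal.ofReal_div_of_pos hden, ← ENNReal.ofReal_ofNat]
      refine eLpNorm_rpow_mul_rpow_le hG hH two_pos (div_pos hnum hden) hs0 hθ.1 hθ.2 ?_
      have := (sub_pos.2 h1).ne'
      field_simp
      ring
    · have htop : timeExponent θ s = ⊤ := by
        rw [timeExponent, heq, sub_self, ENNReal.ofReal_zero, ENNReal.div_zero]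
        simpa using hnum
      rw [htop, ← ENNReal.ofReal_ofNat]
      refine eLpNorm_rpow_mul_rpow_le_top hG hs0 (hθ.1.lt_of_ne ?_) hθ.2 heq
      rintro rfl
      norm_num at heq
  · simp [hθs rfl]

end MixedNorm

theorem mixed_norm_gagliardo_nirenberg
    (d : ℕ) (hd : 2 ≤ d)
    (κ θ r : ℝ)
    (hκ : κ ∈ Set.Icc (2 * (d : ℝ) / ((d : ℝ) + 2)) 2)
    (hθ : θ ∈ Set.Icc (0 : ℝ) 1)
    (hexc : ¬ (θ = 1 ∧ κ = (d : ℝ)))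
    (hr : 2 ≤ r)
    (hbal : 1 / 2 - 1 / r = θ / 2 * (2 / (d : ℝ) + 1 - 2 / κ)) :
    ∃ C : ℝ, 0 < C ∧
      ∀ s : ℝ, 1 ≤ s → s * θ ≤ 2 → (θ = 1 → s = 2) →
        ∀ f : ℝ × EuclideanSpace ℝ (Fin d) → ℝ, ContDiff ℝ ∞ f → HasCompactSupport f →
          mixedNorm (ENNReal.ofReal s) (ENNReal.ofReal r) f ≤
            ENNReal.ofReal C *
              mixedNorm 2 (ENNReal.ofReal κ) (spatialGradient f) ^ θ *
              mixedNorm (timeExponent θ s) 2 f ^ (1 - θ) := by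
  have hfin : Module.finrank ℝ (EuclideanSpace ℝ (Fin d)) = d := by simp
  obtain ⟨C, hC⟩ := exists_gagliardo_nirenberg
    (volume : Measure (EuclideanSpace ℝ (Fin d))) (κ := κ) (θ := θ) (r := r)
    (by rwa [hfin]) (by rwa [hfin]) hθ (by rwa [hfin]) hr (by rwa [hfin])
  have hκ0 : 0 < κ := lt_of_lt_of_le (by positivity) hκ.1
  refine ⟨C + 1, by positivity, fun s hs hsθ hθs f hf hcf => ?_⟩
  set G : ℝ → ℝ≥0∞ := fun t => eLpNorm (fun x => spatialGradient f (t, x)) (ENNReal.ofReal κ) volume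
  set H : ℝ → ℝ≥0∞ := fun t => eLpNorm (fun x => f (t, x)) 2 volume
  have hG : Measurable G := measurable_eLpNorm_slice hκ0 (continuous_spatialGradient hf)
  have hH : Measurable H := by
    simpa [H] using measurable_eLpNorm_slice two_pos hf.continuous
  have hpt : ∀ t, ‖eLpNorm (fun x => f (t, x)) (ENNReal.ofReal r) volume‖ₑ ≤
      C * ‖G t ^ θ * H t ^ (1 - θ)‖ₑ := fun t => by
    have := hC (fun x => f (t, x))
      ((hf.of_le (by simp)).comp (contDiff_prodMk_right t)) (hcf.slice t)
    rw [eLpNorm_congr_norm_ae (.of_forall fun x => (norm_spatialGradient f t x).symm)] at this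
    simpa only [enorm_eq_self, mul_assoc] using this
  have hCle : (C : ℝ≥0∞) ≤ ENNReal.ofReal (C + 1) := by
    rw [← ENNReal.ofReal_coe_nnreal]
    exact ENNReal.ofReal_le_ofReal (by linarith)
  calc mixedNorm (ENNReal.ofReal s) (ENNReal.ofReal r) f
      ≤ C * eLpNorm (fun t => G t ^ θ * H t ^ (1 - θ)) (ENNReal.ofReal s) volume :=
        eLpNorm_le_nnreal_smul_eLpNorm_of_ae_le_mul' (.of_forall hpt) _
    _ ≤ ENNReal.ofReal (C + 1) *
          (eLpNorm G 2 volume ^ θ * eLpNorm H (timeExponent θ s) volume ^ (1 - θ)) := by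
        gcongr
        exact eLpNorm_rpow_mul_rpow_le_timeExponent hG.aemeasurable hH.aemeasurable hs hθ hsθ hθs
    _ = _ := (mul_assoc _ _ _).symm
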